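/- (Conditional positive definiteness of odd-power radial kernels.) Let d ≥ 1, let x₁, …, xₙ ∈ ℝ^d be pairwise distinct points, let q be a nonnegative integer, and let λ ∈ ℝⁿ be a nonzero vector satisfying the moment conditions Σ_{j=1}^n λ_j p(x_j) = 0 for every real polynomial p in d variables of total degree at most q. Then (−1)^{q+1} Σ_{i=1}^n Σ_{j=1}^n λ_i λ_j ‖x_i − x_j‖^{2q+1} > 0. Equivalently, the polyharmonic spline kernel matrix A with entries A_{ij} = ‖x_i − x_j‖^{2q+1} is, up to the sign (−1)^{q+1}, positive definite on the subspace of vectors λ ∈ ℝⁿ satisfying the degree-q moment conditions. -/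

import Mathlib

open MvPolynomial

section ExpRemainder

/-- The remainder of the order-`m` Taylor polynomial of `s ↦ exp (-s)` at `0`, with the sign that
makes it positive on `(0, ∞)`. -/
noncomputable def expRemainder (m : ℕ) (s : ℝ) : ℝ :=
  (-1) ^ m * (Real.exp (-s) - ∑ k ∈ Finset.range m, (-s) ^ k / k.factorial)

lemma expRemainder_zero_left (s : ℝ) : expRemainder 0 s = Real.exp (-s) := by
  simp [expRemainder]

lemma expRemainder_succ (m : ℕ) (s : ℝ) :
    expRemainder (m + 1) s = s ^ m / m.factorial - expRemainder m s := by
  have h : ((-1 : ℝ) ^ m) * (-s) ^ m = s ^ m := by rw [← mul_pow]; simp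
  simp only [expRemainder, Finset.sum_range_succ, pow_succ]
  linear_combination (1 / (m.factorial : ℝ)) * h

lemma expRemainder_succ_zero (m : ℕ) : expRemainder (m + 1) 0 = 0 := by
  induction m with
  | zero => simp [expRemainder]
  | succ m ih => rw [expRemainder_succ, ih]; simp

lemma hasDerivAt_expRemainder_succ (m : ℕ) (s : ℝ) :
    HasDerivAt (expRemainder (m + 1)) (expRemainder m s) s := by
  induction m with
  | zero =>
    have h : expRemainder 1 = fun s => 1 - Real.exp (-s) := by
      ext s; simp [expRemainder]
    rw [zero_add, h, expRemainder_zero_left]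
    simpa using ((hasDerivAt_neg s).exp).const_sub 1
  | succ m ih =>
    have h : expRemainder (m + 1 + 1) =
        fun s => s ^ (m + 1) / (m + 1).factorial - expRemainder (m + 1) s := by
      ext s; exact expRemainder_succ _ _
    rw [h, expRemainder_succ m s]
    refine (((hasDerivAt_pow (m + 1) s).div_const _).sub ih).congr_deriv ?_
    rw [Nat.factorial_succ]
    have := Nat.cast_add_one_ne_zero (R := ℝ) m
    push_cast
    field_simp

lemma continuous_expRemainder (m : ℕ) : Continuous (expRemainder m) := by
  unfold expRemainder; fun_prop

lemma expRemainder_pos (m : ℕ) {s : ℝ} (hs : 0 < s) : 0 < expRemainder m s := by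
  induction m generalizing s with
  | zero => rw [expRemainder_zero_left]; positivity
  | succ m ih =>
    have h : StrictMonoOn (expRemainder (m + 1)) (Set.Ici 0) := by
      refine strictMonoOn_of_deriv_pos (convex_Ici 0) (continuous_expRemainder _).continuousOn ?_
      intro x hx
      rw [interior_Ici] at hx
      rw [(hasDerivAt_expRemainder_succ m x).deriv]
      exact ih hx
    simpa [expRemainder_succ_zero] using h Set.self_mem_Ici hs.le hs

lemma expRemainder_le (m : ℕ) {s : ℝ} (hs : 0 < s) :
    expRemainder m s ≤ s ^ m / m.factorial := by
  have := expRemainder_pos (m + 1) hs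
  rw [expRemainder_succ] at this
  linarith

lemma expRemainder_succ_le (m : ℕ) {s : ℝ} (hs : 0 < s) :
    expRemainder (m + 1) s ≤ s ^ m / m.factorial := by
  rw [expRemainder_succ]
  linarith [expRemainder_pos m hs]

lemma integrableOn_expRemainder_mul_rpow (q : ℕ) :
    MeasureTheory.IntegrableOn
      (fun t : ℝ => expRemainder (q + 1) t * t ^ (-(q : ℝ) - 3 / 2)) (Set.Ioi 0) := by
  have hmeas : Measurable (fun t : ℝ => expRemainder (q + 1) t * t ^ (-(q : ℝ) - 3 / 2)) :=
    (continuous_expRemainder _).measurable.mul (measurable_id.pow_const _)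
  have hbound (t : ℝ) (ht : 0 < t) (n : ℕ) (h : expRemainder (q + 1) t ≤ t ^ n / n.factorial) :
      ‖expRemainder (q + 1) t * t ^ (-(q : ℝ) - 3 / 2)‖ ≤ t ^ ((n : ℝ) - q - 3 / 2) := by
    rw [Real.norm_of_nonneg (mul_nonneg (expRemainder_pos _ ht).le (by positivity))]
    have h1 : t ^ n / n.factorial ≤ t ^ n :=
      div_le_self (by positivity) (by exact_mod_cast n.factorial_pos)
    calc _ ≤ t ^ n * t ^ (-(q : ℝ) - 3 / 2) := by gcongr; exact h.trans h1
      _ = _ := by rw [← Real.rpow_natCast, ← Real.rpow_add ht]; ring_nf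
  rw [← Set.Ioc_union_Ioi_eq_Ioi (zero_le_one' ℝ)]
  refine MeasureTheory.IntegrableOn.union ?_ ?_
  · have h : MeasureTheory.IntegrableOn (fun t : ℝ => t ^ (-(1 / 2) : ℝ)) (Set.Ioc 0 1) :=
      (intervalIntegrable_iff_integrableOn_Ioc_of_le zero_le_one).1
        (intervalIntegral.intervalIntegrable_rpow' (by norm_num))
    refine h.mono' hmeas.aestronglyMeasurable ?_
    refine (MeasureTheory.ae_restrict_iff' measurableSet_Ioc).2 (.of_forall fun t ht => ?_)
    convert hbound t ht.1 (q + 1) (expRemainder_le _ ht.1) using 2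
    push_cast; ring
  · have h : MeasureTheory.IntegrableOn (fun t : ℝ => t ^ (-(3 / 2) : ℝ)) (Set.Ioi 1) :=
      integrableOn_Ioi_rpow_of_lt (by norm_num) one_pos
    refine h.mono' hmeas.aestronglyMeasurable ?_
    refine (MeasureTheory.ae_restrict_iff' measurableSet_Ioi).2 (.of_forall fun t ht => ?_)
    have ht0 : 0 < t := one_pos.trans ht
    convert hbound t ht0 q (expRemainder_succ_le _ ht0) using 2
    ring

/-- An integral over `(0, ∞)` of a function positive there is positive. -/
lemma setIntegral_Ioi_pos {f : ℝ → ℝ} (hf : ∀ t, 0 < t → 0 < f t)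
    (hfi : MeasureTheory.IntegrableOn f (Set.Ioi 0)) : 0 < ∫ t in Set.Ioi 0, f t := by
  rw [MeasureTheory.setIntegral_pos_iff_support_of_nonneg_ae
    ((MeasureTheory.ae_restrict_iff' measurableSet_Ioi).2 (.of_forall fun t ht => (hf t ht).le)) hfi,
    Set.inter_eq_right.2 (show Set.Ioi 0 ⊆ f.support from fun t ht => (hf t ht).ne')]
  simp

lemma expRemainder_mul_rpow_scale (q : ℕ) {s t : ℝ} (hs : 0 < s) (ht : 0 < t) :
    expRemainder (q + 1) (s * t) * t ^ (-(q : ℝ) - 3 / 2) =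
      s ^ ((q : ℝ) + 3 / 2) * (expRemainder (q + 1) (s * t) * (s * t) ^ (-(q : ℝ) - 3 / 2)) := by
  rw [Real.mul_rpow hs.le ht.le]
  have h : s ^ ((q : ℝ) + 3 / 2) * s ^ (-(q : ℝ) - 3 / 2) = 1 := by
    rw [← Real.rpow_add hs]; ring_nf; simp
  linear_combination -(expRemainder (q + 1) (s * t) * t ^ (-(q : ℝ) - 3 / 2)) * h

lemma integrableOn_expRemainder_sq_mul (q : ℕ) {r : ℝ} (hr : 0 ≤ r) :
    MeasureTheory.IntegrableOn
      (fun t : ℝ => expRemainder (q + 1) (r ^ 2 * t) * t ^ (-(q : ℝ) - 3 / 2)) (Set.Ioi 0) := by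
  rcases hr.eq_or_lt with rfl | hr
  · simp [expRemainder_succ_zero]
  have hs : 0 < r ^ 2 := by positivity
  have h := (MeasureTheory.integrableOn_Ioi_comp_mul_left_iff
    (fun t : ℝ => expRemainder (q + 1) t * t ^ (-(q : ℝ) - 3 / 2)) 0 hs).2
    (by simpa using integrableOn_expRemainder_mul_rpow q)
  exact MeasureTheory.IntegrableOn.congr_fun (h.const_mul ((r ^ 2) ^ ((q : ℝ) + 3 / 2)))
    (fun t ht => (expRemainder_mul_rpow_scale q hs ht).symm) measurableSet_Ioi

/-- The odd power `r ^ (2 * q + 1)` as a mixture of Taylor remainders of Gaussians. -/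
lemma integral_expRemainder_sq_mul (q : ℕ) {r : ℝ} (hr : 0 ≤ r) :
    ∫ t in Set.Ioi 0, expRemainder (q + 1) (r ^ 2 * t) * t ^ (-(q : ℝ) - 3 / 2) =
      r ^ (2 * q + 1) *
        ∫ t in Set.Ioi 0, expRemainder (q + 1) t * t ^ (-(q : ℝ) - 3 / 2) := by
  rcases hr.eq_or_lt with rfl | hr
  · simp [expRemainder_succ_zero]
  have hs : 0 < r ^ 2 := by positivity
  rw [MeasureTheory.setIntegral_congr_fun measurableSet_Ioi
    (fun t ht => expRemainder_mul_rpow_scale q hs ht), MeasureTheory.integral_const_mul,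
    MeasureTheory.integral_comp_mul_left_Ioi
      (fun t : ℝ => expRemainder (q + 1) t * t ^ (-(q : ℝ) - 3 / 2)) 0 hs, mul_zero, smul_eq_mul,
    ← mul_assoc]
  congr 1
  rw [← Real.rpow_neg_one, ← Real.rpow_add hs, ← Real.rpow_natCast r 2, ← Real.rpow_mul hr.le,
    ← Real.rpow_natCast]
  congr 1
  push_cast; ring

end ExpRemainder

section Gaussian

variable {ι E : Type*} [Fintype ι] [NormedAddCommGroup E] [InnerProductSpace ℝ E]

/-- Exponentials of distinct linear forms are linearly independent. -/
lemma eq_zero_of_sum_mul_exp_inner_eq_zero {x : ι → E} (hx : Function.Injective x) {c : ι → ℝ}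
    (h : ∀ z : E, ∑ i, c i * Real.exp (inner ℝ (x i) z) = 0) : c = 0 := by
  let χ : ι → (Multiplicative E →* ℝ) := fun i =>
    { toFun := fun z => Real.exp (inner ℝ (x i) z.toAdd)
      map_one' := by simp
      map_mul' := fun a b => by simp [inner_add_right, Real.exp_add] }
  have hχ : Function.Injective χ := fun i j hij => hx <| ext_inner_right ℝ fun z =>
    Real.exp_injective (DFunLike.congr_fun hij (Multiplicative.ofAdd z))
  have hli := (linearIndependent_monoidHom (Multiplicative E) ℝ).comp χ hχ
  rw [Fintype.linearIndependent_iff] at hli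
  ext i
  refine hli c ?_ i
  ext z
  simpa [χ, Finset.sum_apply] using h z.toAdd

lemma eq_zero_of_sum_mul_gaussian_eq_zero {x : ι → E} (hx : Function.Injective x) {c : ι → ℝ}
    {b : ℝ} (hb : b ≠ 0) (h : ∀ z : E, ∑ i, c i * Real.exp (-b * ‖z - x i‖ ^ 2) = 0) : c = 0 := by
  have hμ : (fun i => c i * Real.exp (-b * ‖x i‖ ^ 2)) = 0 := by
    refine eq_zero_of_sum_mul_exp_inner_eq_zero hx fun z => ?_
    have hz := congrArg (Real.exp (b * ‖(2 * b)⁻¹ • z‖ ^ 2) * ·) (h ((2 * b)⁻¹ • z))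
    simp only [mul_zero, Finset.mul_sum] at hz
    rw [← hz]
    refine Finset.sum_congr rfl fun i _ => ?_
    rw [mul_assoc, ← Real.exp_add, mul_left_comm, ← Real.exp_add, norm_sub_sq_real,
      real_inner_smul_left, real_inner_comm]
    congr 2
    field_simp
    ring
  ext i
  simpa using congrFun hμ i

lemma exp_mul_exp_gaussian (b : ℝ) (x y z : E) :
    Real.exp (-b * ‖z - x‖ ^ 2) * Real.exp (-b * ‖z - y‖ ^ 2) =
      Real.exp (-(b / 2) * ‖x - y‖ ^ 2) *
        Real.exp (-(2 * b) * ‖z - (1 / 2 : ℝ) • (x + y)‖ ^ 2) := by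
  rw [← Real.exp_add, ← Real.exp_add]
  congr 1
  simp only [norm_sub_sq_real, norm_smul, mul_pow, norm_add_sq_real, real_inner_smul_right,
    inner_add_right]
  norm_num
  ring

variable [FiniteDimensional ℝ E] [MeasurableSpace E] [BorelSpace E]

lemma integrable_exp_neg_mul_sq_norm {b : ℝ} (hb : 0 < b) :
    MeasureTheory.Integrable fun z : E => Real.exp (-b * ‖z‖ ^ 2) := by
  refine not_imp_comm.1 MeasureTheory.integral_undef ?_
  rw [GaussianFourier.integral_rexp_neg_mul_sq_norm hb]
  positivity

/-- The Gaussian kernel is strictly positive definite. -/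
lemma gaussian_kernel_pos {x : ι → E} (hx : Function.Injective x) {c : ι → ℝ} (hc : c ≠ 0)
    {t : ℝ} (ht : 0 < t) :
    0 < ∑ i, ∑ j, c i * c j * Real.exp (-(‖x i - x j‖ ^ 2 * t)) := by
  set b := 2 * t with hb
  have hb0 : 0 < b := by positivity
  have hsq (z : E) : (∑ i, c i * Real.exp (-b * ‖z - x i‖ ^ 2)) ^ 2 =
      ∑ i, ∑ j, c i * c j * Real.exp (-(‖x i - x j‖ ^ 2 * t)) *
        Real.exp (-(2 * b) * ‖z - (1 / 2 : ℝ) • (x i + x j)‖ ^ 2) := by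
    rw [sq, Finset.sum_mul_sum]
    refine Finset.sum_congr rfl fun i _ => Finset.sum_congr rfl fun j _ => ?_
    rw [mul_mul_mul_comm, exp_mul_exp_gaussian, ← mul_assoc]
    congr 3
    rw [hb]; ring
  have hint (w : E) : MeasureTheory.Integrable
      fun z : E => Real.exp (-(2 * b) * ‖z - w‖ ^ 2) :=
    (integrable_exp_neg_mul_sq_norm (by positivity)).comp_sub_right w
  obtain ⟨z₀, hz₀⟩ : ∃ z : E, ∑ i, c i * Real.exp (-b * ‖z - x i‖ ^ 2) ≠ 0 := by
    by_contra! h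
    exact hc (eq_zero_of_sum_mul_gaussian_eq_zero hx hb0.ne' h)
  have hpos : 0 < ∫ z : E, (∑ i, c i * Real.exp (-b * ‖z - x i‖ ^ 2)) ^ 2 := by
    refine MeasureTheory.integral_pos_of_integrable_nonneg_nonzero (by fun_prop) ?_
      (fun z => sq_nonneg _) (pow_ne_zero 2 hz₀)
    simp only [hsq]
    exact MeasureTheory.integrable_finsetSum _ fun i _ =>
      MeasureTheory.integrable_finsetSum _ fun j _ => (hint _).const_mul _
  have heq : ∫ z : E, (∑ i, c i * Real.exp (-b * ‖z - x i‖ ^ 2)) ^ 2 =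
      (∑ i, ∑ j, c i * c j * Real.exp (-(‖x i - x j‖ ^ 2 * t))) *
        ∫ z : E, Real.exp (-(2 * b) * ‖z‖ ^ 2) := by
    simp only [hsq]
    rw [MeasureTheory.integral_finsetSum _ fun i _ =>
      MeasureTheory.integrable_finsetSum _ fun j _ => (hint _).const_mul _, Finset.sum_mul]
    refine Finset.sum_congr rfl fun i _ => ?_
    rw [MeasureTheory.integral_finsetSum _ fun j _ => (hint _).const_mul _, Finset.sum_mul]
    refine Finset.sum_congr rfl fun j _ => ?_
    rw [MeasureTheory.integral_const_mul,
      MeasureTheory.integral_sub_right_eq_self (fun z : E => Real.exp (-(2 * b) * ‖z‖ ^ 2))]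
  rw [heq] at hpos
  exact pos_of_mul_pos_left hpos (MeasureTheory.integral_nonneg fun z => (Real.exp_pos _).le)

end Gaussian

section Moments

variable {d n q : ℕ} {x : Fin n → EuclideanSpace ℝ (Fin d)} {lam : Fin n → ℝ}

lemma sum_mul_norm_pow_mul_inner_pow_eq_zero
    (hmom : ∀ p : MvPolynomial (Fin d) ℝ, p.totalDegree ≤ q →
      ∑ j, lam j * eval (fun k => x j k) p = 0)
    (y : EuclideanSpace ℝ (Fin d)) {a b : ℕ} (hab : 2 * a + b ≤ q) :
    ∑ j, lam j * ((‖x j‖ ^ 2) ^ a * inner ℝ (x j) y ^ b) = 0 := by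
  have hN : (∑ k : Fin d, (X k : MvPolynomial (Fin d) ℝ) ^ 2).totalDegree ≤ 2 :=
    totalDegree_finsetSum_le fun k _ => (totalDegree_X_pow k 2).le
  have hL : (∑ k : Fin d, C (y k) * (X k : MvPolynomial (Fin d) ℝ)).totalDegree ≤ 1 :=
    totalDegree_finsetSum_le fun k _ =>
      (totalDegree_mul _ _).trans (by simp [totalDegree_C, totalDegree_X])
  have h := hmom ((∑ k, X k ^ 2) ^ a * (∑ k, C (y k) * X k) ^ b) <| by
    refine (totalDegree_mul _ _).trans (le_trans (add_le_add ((totalDegree_pow _ _).trans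
      (Nat.mul_le_mul_left a hN)) ((totalDegree_pow _ _).trans (Nat.mul_le_mul_left b hL))) ?_)
    omega
  rw [← h]
  refine Finset.sum_congr rfl fun j _ => ?_
  simp [EuclideanSpace.norm_sq_eq, PiLp.inner_apply]

/-- Under the moment conditions of order `q`, even-power kernels of degree at most `2 * q`
vanish. -/
lemma sum_sum_mul_norm_sub_pow_eq_zero
    (hmom : ∀ p : MvPolynomial (Fin d) ℝ, p.totalDegree ≤ q →
      ∑ j, lam j * eval (fun k => x j k) p = 0) {k : ℕ} (hk : k ≤ q) :
    ∑ i, ∑ j, lam i * lam j * (‖x i - x j‖ ^ 2) ^ k = 0 := by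
  have hexp (i j : Fin n) : lam i * lam j * (‖x i - x j‖ ^ 2) ^ k =
      ∑ m ∈ Finset.range (k + 1), ∑ l ∈ Finset.range (m + 1),
        ((-2) ^ (k - m) * k.choose m * m.choose l) *
          ((lam i * ((‖x i‖ ^ 2) ^ l)) * (lam j * ((‖x j‖ ^ 2) ^ (m - l)))
            * inner ℝ (x i) (x j) ^ (k - m)) := by
    have h : ‖x i - x j‖ ^ 2 = (‖x i‖ ^ 2 + ‖x j‖ ^ 2) + (-2) * inner ℝ (x i) (x j) := by
      rw [norm_sub_sq_real]; ring
    rw [h, add_pow, Finset.mul_sum]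
    refine Finset.sum_congr rfl fun m _ => ?_
    rw [add_pow, Finset.sum_mul, Finset.sum_mul, Finset.mul_sum]
    refine Finset.sum_congr rfl fun l _ => ?_
    rw [mul_pow]
    ring
  simp only [hexp]
  have hcomm (i : Fin n) := Finset.sum_comm (s := (Finset.univ : Finset (Fin n)))
    (t := Finset.range (k + 1)) (f := fun j m => ∑ l ∈ Finset.range (m + 1),
        ((-2) ^ (k - m) * k.choose m * m.choose l) *
          ((lam i * ((‖x i‖ ^ 2) ^ l)) * (lam j * ((‖x j‖ ^ 2) ^ (m - l)))
            * inner ℝ (x i) (x j) ^ (k - m)))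
  simp only [hcomm]
  rw [Finset.sum_comm]
  refine Finset.sum_eq_zero fun m hm => ?_
  have hcomm' (i : Fin n) := Finset.sum_comm (s := (Finset.univ : Finset (Fin n)))
    (t := Finset.range (m + 1)) (f := fun j l =>
        ((-2) ^ (k - m) * k.choose m * m.choose l) *
          ((lam i * ((‖x i‖ ^ 2) ^ l)) * (lam j * ((‖x j‖ ^ 2) ^ (m - l)))
            * inner ℝ (x i) (x j) ^ (k - m)))
  simp only [hcomm']
  rw [Finset.sum_comm]
  refine Finset.sum_eq_zero fun l hl => ?_
  rw [Finset.mem_range] at hm hl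
  simp only [← Finset.mul_sum]
  refine mul_eq_zero_of_right _ ?_
  rcases le_total (2 * l) m with hlm | hlm
  · rw [Finset.sum_comm]
    refine Finset.sum_eq_zero fun j _ => ?_
    have h := sum_mul_norm_pow_mul_inner_pow_eq_zero hmom (x j) (a := l) (b := k - m) (by omega)
    rw [← mul_zero (lam j * (‖x j‖ ^ 2) ^ (m - l)), ← h, Finset.mul_sum]
    exact Finset.sum_congr rfl fun i _ => by ring
  · refine Finset.sum_eq_zero fun i _ => ?_
    have h := sum_mul_norm_pow_mul_inner_pow_eq_zero hmom (x i) (a := m - l) (b := k - m) (by omega)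
    rw [← mul_zero (lam i * (‖x i‖ ^ 2) ^ l), ← h, Finset.mul_sum]
    exact Finset.sum_congr rfl fun j _ => by rw [real_inner_comm]; ring

lemma sum_sum_mul_expRemainder_eq
    (hmom : ∀ p : MvPolynomial (Fin d) ℝ, p.totalDegree ≤ q →
      ∑ j, lam j * eval (fun k => x j k) p = 0) {m : ℕ} (hm : m ≤ q + 1) (t : ℝ) :
    ∑ i, ∑ j, lam i * lam j * expRemainder m (‖x i - x j‖ ^ 2 * t) =
      (-1) ^ m * ∑ i, ∑ j, lam i * lam j * Real.exp (-(‖x i - x j‖ ^ 2 * t)) := by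
  induction m with
  | zero => simp [expRemainder_zero_left]
  | succ m ih =>
    have h := sum_sum_mul_norm_sub_pow_eq_zero hmom (k := m) (by omega)
    have hstep (i j : Fin n) : lam i * lam j * expRemainder (m + 1) (‖x i - x j‖ ^ 2 * t) =
        t ^ m / m.factorial * (lam i * lam j * (‖x i - x j‖ ^ 2) ^ m) -
          lam i * lam j * expRemainder m (‖x i - x j‖ ^ 2 * t) := by
      rw [expRemainder_succ, mul_pow]; ring
    simp only [hstep, Finset.sum_sub_distrib, ← Finset.mul_sum]
    rw [h, ih (by omega), pow_succ]
    ring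

end Moments

/-- Conditional positive definiteness of odd-power radial (polyharmonic spline)
kernels: for pairwise distinct nodes `x₁, …, xₙ ∈ ℝ^d` and a nonzero vector `λ`
satisfying the degree-`q` moment conditions, the quadratic form of the kernel
`‖xᵢ − xⱼ‖^(2q+1)` is, up to the sign `(−1)^(q+1)`, strictly positive. -/
theorem phs_kernel_conditionally_positive_definite
    (d n : ℕ) (hd : 1 ≤ d)
    (x : Fin n → EuclideanSpace ℝ (Fin d)) (hx : Function.Injective x)
    (q : ℕ) (lam : Fin n → ℝ) (hlam : lam ≠ 0)
    (hmom : ∀ p : MvPolynomial (Fin d) ℝ, p.totalDegree ≤ q →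
      ∑ j, lam j * eval (fun k => x j k) p = 0) :
    0 < (-1 : ℝ) ^ (q + 1) *
      ∑ i, ∑ j, lam i * lam j * ‖x i - x j‖ ^ (2 * q + 1) := by
  set J : ℝ := ∫ t in Set.Ioi 0, expRemainder (q + 1) t * t ^ (-(q : ℝ) - 3 / 2) with hJ
  have hJpos : 0 < J := setIntegral_Ioi_pos
    (fun t ht => mul_pos (expRemainder_pos _ ht) (Real.rpow_pos_of_pos ht _))
    (integrableOn_expRemainder_mul_rpow q)
  have hint (i j : Fin n) : MeasureTheory.IntegrableOn (fun t : ℝ => lam i * lam j *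
      (expRemainder (q + 1) (‖x i - x j‖ ^ 2 * t) * t ^ (-(q : ℝ) - 3 / 2))) (Set.Ioi 0) :=
    (integrableOn_expRemainder_sq_mul q (norm_nonneg _)).const_mul _
  have hint₁ (i : Fin n) : MeasureTheory.IntegrableOn (fun t : ℝ => ∑ j, lam i * lam j *
      (expRemainder (q + 1) (‖x i - x j‖ ^ 2 * t) * t ^ (-(q : ℝ) - 3 / 2))) (Set.Ioi 0) :=
    MeasureTheory.integrable_finsetSum _ fun j _ => hint i j
  have hmix : J * ∑ i, ∑ j, lam i * lam j * ‖x i - x j‖ ^ (2 * q + 1) =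
      ∫ t in Set.Ioi 0, ∑ i, ∑ j, lam i * lam j *
        (expRemainder (q + 1) (‖x i - x j‖ ^ 2 * t) * t ^ (-(q : ℝ) - 3 / 2)) := by
    rw [MeasureTheory.integral_finsetSum _ fun i _ => hint₁ i, Finset.mul_sum]
    refine Finset.sum_congr rfl fun i _ => ?_
    rw [MeasureTheory.integral_finsetSum _ fun j _ => hint i j, Finset.mul_sum]
    refine Finset.sum_congr rfl fun j _ => ?_
    rw [MeasureTheory.integral_const_mul, integral_expRemainder_sq_mul q (norm_nonneg _)]
    ring
  refine pos_of_mul_pos_right (a := J) ?_ hJpos.le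
  rw [mul_left_comm, hmix, ← MeasureTheory.integral_const_mul]
  refine setIntegral_Ioi_pos (fun t ht => ?_)
    ((MeasureTheory.integrable_finsetSum _ fun i _ => hint₁ i).const_mul _)
  simp only [← mul_assoc (lam _ * lam _), ← Finset.sum_mul]
  rw [sum_sum_mul_expRemainder_eq hmom le_rfl, ← mul_assoc, ← mul_assoc, ← mul_pow]
  simpa using mul_pos (gaussian_kernel_pos hx hlam ht) (Real.rpow_pos_of_pos ht _)
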